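/- Let 𝔸 = (A_n)_{n∈ℤ⁺} be a sequence of invertible linear operators on ℝ^d and 𝒮 = (‖·‖_n)_{n∈ℤ⁺} a sequence of norms on ℝ^d for which there exist K,a>0 such that ‖𝒜(m,n)x‖_m ≤ Ke^{a(m-n)}‖x‖_n and ‖𝒜(n,m)x‖_n ≤ Ke^{a(m-n)}‖x‖_m for all m≥n≥0 and x∈ℝ^d. Let Σ := Σ_{ED,𝔸,𝒮}. Then for all r₁,r₂ ∈ (0,∞)∖Σ with r₁ < r₂, the following are equivalent: (1) S_{r₁}(n) = S_{r₂}(n) for some n∈ℤ⁺ (equivalently, for all n∈ℤ⁺); (2) [r₁,r₂] ∩ Σ = ∅. -/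

import Mathlib

noncomputable section

namespace NonautLin

variable {E : Type*} [NormedAddCommGroup E] [NormedSpace ℝ E]

/-- `N : E → ℝ` is a norm on the real vector space `E`. -/
def IsNormOn (N : E → ℝ) : Prop :=
  (∀ x, 0 ≤ N x) ∧ (∀ x, N x = 0 ↔ x = 0) ∧
  (∀ (c : ℝ) (x : E), N (c • x) = |c| * N x) ∧
  (∀ x y : E, N (x + y) ≤ N x + N y)

/-- Multiplication by the scalar `c` as a continuous linear equivalence
(junk value `id` for `c = 0`). -/
def smulCLE (c : ℝ) : E ≃L[ℝ] E :=
  if hc : c = 0 then ContinuousLinearEquiv.refl ℝ E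
  else
    { toFun := fun x => c • x
      invFun := fun x => c⁻¹ • x
      map_add' := fun x y => smul_add c x y
      map_smul' := fun a x => smul_comm c a x
      left_inv := fun x => by simp [smul_smul, inv_mul_cancel₀ hc]
      right_inv := fun x => by simp [smul_smul, mul_inv_cancel₀ hc]
      continuous_toFun := continuous_const_smul c
      continuous_invFun := continuous_const_smul c⁻¹ }

/-- The operator `c • A` as a continuous linear equivalence. -/
def scale (c : ℝ) (A : E ≃L[ℝ] E) : E ≃L[ℝ] E := A.trans (smulCLE c)

/-- `fwd A n k` is the composition `A (n+k-1) ∘ ⋯ ∘ A n`. -/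
def fwd (A : ℕ → (E ≃L[ℝ] E)) (n : ℕ) : ℕ → (E ≃L[ℝ] E)
  | 0 => ContinuousLinearEquiv.refl ℝ E
  | k + 1 => (fwd A n k).trans (A (n + k))

/-- The cocycle `𝒜(m,n)` associated with the one-sided sequence `A`:
`𝒜(m,n) = A (m-1) ∘ ⋯ ∘ A n` for `m > n`, `𝒜(n,n) = Id`, and
`𝒜(m,n) = (𝒜(n,m))⁻¹` for `m < n`. -/
def coc (A : ℕ → (E ≃L[ℝ] E)) (m n : ℕ) : E ≃L[ℝ] E :=
  if n ≤ m then fwd A n (m - n) else (fwd A m (n - m)).symm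

/-- Strong exponential dichotomy, over `ℤ⁺`, with respect to a sequence of norms and a
given sequence of projections. -/
def StrongExpDichotomyWRTProj (B : ℕ → (E ≃L[ℝ] E)) (N : ℕ → E → ℝ)
    (P : ℕ → (E →L[ℝ] E)) : Prop :=
  ∃ K lam a : ℝ, 0 < K ∧ 0 < lam ∧ lam ≤ a ∧
    (∀ n, (P n).comp (P n) = P n) ∧
    (∀ n, ((B n : E →L[ℝ] E)).comp (P n) = (P (n + 1)).comp (B n : E →L[ℝ] E)) ∧
    (∀ m n : ℕ, n ≤ m → ∀ x : E,
      N m (coc B m n (P n x)) ≤ K * Real.exp (-lam * ((m : ℝ) - n)) * N n x ∧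
      N n (coc B n m (x - P m x)) ≤ K * Real.exp (-lam * ((m : ℝ) - n)) * N m x ∧
      N m (coc B m n x) ≤ K * Real.exp (a * ((m : ℝ) - n)) * N n x ∧
      N n (coc B n m x) ≤ K * Real.exp (a * ((m : ℝ) - n)) * N m x)

/-- Strong exponential dichotomy, over `ℤ⁺`, with respect to a sequence of norms. -/
def StrongExpDichotomyWRT (B : ℕ → (E ≃L[ℝ] E)) (N : ℕ → E → ℝ) : Prop :=
  ∃ P : ℕ → (E →L[ℝ] E), StrongExpDichotomyWRTProj B N P

/-- The exponential dichotomy spectrum over `ℤ⁺`: the set of `τ > 0` such that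
`((1/τ) B_n)` does not admit a strong exponential dichotomy w.r.t. the norms `N`. -/
def SigmaED (B : ℕ → (E ≃L[ℝ] E)) (N : ℕ → E → ℝ) : Set ℝ :=
  {τ | 0 < τ ∧ ¬ StrongExpDichotomyWRT (fun n => scale τ⁻¹ (B n)) N}

/-- The set `S_r(n) = {v : sup_{m ≥ n} r^{-(m-n)} ‖𝒜(m,n)v‖_m < ∞}`. -/
def SetS (A : ℕ → (E ≃L[ℝ] E)) (N : ℕ → E → ℝ) (r : ℝ) (n : ℕ) : Set E :=
  {v | ∃ C : ℝ, ∀ m : ℕ, n ≤ m → r ^ (-((m : ℝ) - n)) * N m (coc A m n v) ≤ C}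

section Cocycle

variable (A : ℕ → (E ≃L[ℝ] E))

theorem coc_add_left (n k : ℕ) : coc A (n + k) n = fwd A n k := by
  simp [coc]

theorem coc_add_right (n k : ℕ) : coc A n (n + k) = (fwd A n k).symm := by
  rcases Nat.eq_zero_or_pos k with rfl | hk
  · ext x; simp [coc, fwd]
  · have : ¬ n + k ≤ n := by omega
    simp [coc, this]

theorem scale_apply {c : ℝ} (hc : c ≠ 0) (B : E ≃L[ℝ] E) (x : E) :
    scale c B x = c • B x := by
  simp only [scale, smulCLE, dif_neg hc]
  rfl

theorem fwd_scale_apply {c : ℝ} (hc : c ≠ 0) (n k : ℕ) (x : E) :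
    fwd (fun i => scale c (A i)) n k x = c ^ k • fwd A n k x := by
  induction k with
  | zero => simp [fwd]
  | succ k ih =>
    simp only [fwd, ContinuousLinearEquiv.trans_apply, ih, scale_apply hc, map_smul, smul_smul]
    rw [pow_succ']

theorem fwd_scale_symm_apply {c : ℝ} (hc : c ≠ 0) (n k : ℕ) (x : E) :
    (fwd (fun i => scale c (A i)) n k).symm x = (c⁻¹) ^ k • (fwd A n k).symm x := by
  rw [ContinuousLinearEquiv.symm_apply_eq, fwd_scale_apply A hc, map_smul, smul_smul,
    ← mul_pow, mul_inv_cancel₀ hc]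
  simp

theorem fwd_succ_apply' (n k : ℕ) (x : E) : fwd A n (k + 1) x = fwd A (n + 1) k (A n x) := by
  induction k with
  | zero => simp [fwd]
  | succ k ih =>
    rw [fwd, ContinuousLinearEquiv.trans_apply, ih, fwd, ContinuousLinearEquiv.trans_apply,
      show n + (k + 1) = n + 1 + k by omega]

theorem fwd_comm_of_invariant {P : ℕ → (E →L[ℝ] E)}
    (hP : ∀ n x, A n (P n x) = P (n + 1) (A n x)) (n k : ℕ) (x : E) :
    fwd A n k (P n x) = P (n + k) (fwd A n k x) := by
  induction k with
  | zero => simp [fwd]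
  | succ k ih => simp only [fwd, ContinuousLinearEquiv.trans_apply, ih, hP]; rfl

end Cocycle

theorem IsNormOn.map_smul_of_nonneg {N : E → ℝ} (hN : IsNormOn N) {c : ℝ} (hc : 0 ≤ c) (x : E) :
    N (c • x) = c * N x := by
  rw [hN.2.2.1, abs_of_nonneg hc]

theorem exp_mul_natCast_add_sub (b : ℝ) (n k : ℕ) :
    Real.exp (b * (((n + k : ℕ) : ℝ) - n)) = Real.exp b ^ k := by
  rw [← Real.exp_nat_mul]
  congr 1
  push_cast
  ring

/-- An invariant splitting along which the images of the projections grow at rate at most `α`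
and their kernels at rate at least `β`. -/
structure HasSplitting (A : ℕ → (E ≃L[ℝ] E)) (N : ℕ → E → ℝ) (P : ℕ → (E →L[ℝ] E))
    (K α β : ℝ) : Prop where
  idem : ∀ n x, P n (P n x) = P n x
  comm : ∀ n x, A n (P n x) = P (n + 1) (A n x)
  stable : ∀ n k x, N (n + k) (fwd A n k (P n x)) ≤ K * α ^ k * N n x
  unstable : ∀ n k x, β ^ k * N n (x - P n x) ≤ K * N (n + k) (fwd A n k x)

section Splitting

variable {A : ℕ → (E ≃L[ℝ] E)} {N : ℕ → E → ℝ}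

theorem mem_setS_iff {r : ℝ} (hr : 0 < r) {n : ℕ} {v : E} :
    v ∈ SetS A N r n ↔ ∃ C : ℝ, ∀ k : ℕ, N (n + k) (fwd A n k v) ≤ C * r ^ k := by
  have key (k : ℕ) : r ^ (-(((n + k : ℕ) : ℝ) - n)) = (r ^ k)⁻¹ := by
    rw [Real.rpow_neg hr.le, ← Real.rpow_natCast]
    congr 2
    push_cast
    ring
  refine exists_congr fun C => ⟨fun h k => ?_, fun h m hm => ?_⟩
  · have h1 := h (n + k) (Nat.le_add_right n k)
    rwa [coc_add_left, key, inv_mul_le_iff₀ (by positivity), mul_comm] at h1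
  · obtain ⟨k, rfl⟩ := Nat.exists_eq_add_of_le hm
    rw [coc_add_left, key, inv_mul_le_iff₀ (by positivity), mul_comm]
    exact h k

theorem mem_setS_succ_iff {r : ℝ} (hr : 0 < r) {n : ℕ} {v : E} :
    A n v ∈ SetS A N r (n + 1) ↔ v ∈ SetS A N r n := by
  rw [mem_setS_iff hr, mem_setS_iff hr]
  constructor
  · rintro ⟨C, hC⟩
    refine ⟨max (N n v) (C / r), fun k => ?_⟩
    cases k with
    | zero => simp [fwd]
    | succ k =>
      have h := hC k
      rw [← fwd_succ_apply', show n + 1 + k = n + (k + 1) by omega] at h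
      calc _ ≤ C * r ^ k := h
        _ = C / r * r ^ (k + 1) := by field_simp; ring
        _ ≤ _ := by gcongr; exact le_max_right _ _
  · rintro ⟨C, hC⟩
    refine ⟨C * r, fun k => ?_⟩
    have h := hC (k + 1)
    rw [fwd_succ_apply', show n + (k + 1) = n + 1 + k by omega] at h
    calc _ ≤ C * r ^ (k + 1) := h
      _ = _ := by ring

theorem setS_eq_succ_iff {r s : ℝ} (hr : 0 < r) (hs : 0 < s) (n : ℕ) :
    SetS A N r (n + 1) = SetS A N s (n + 1) ↔ SetS A N r n = SetS A N s n := by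
  simp only [Set.ext_iff]
  rw [(A n).surjective.forall]
  simp only [mem_setS_succ_iff hr, mem_setS_succ_iff hs]

theorem setS_eq_iff_zero {r s : ℝ} (hr : 0 < r) (hs : 0 < s) (n : ℕ) :
    SetS A N r n = SetS A N s n ↔ SetS A N r 0 = SetS A N s 0 := by
  induction n with
  | zero => rfl
  | succ n ih => rw [setS_eq_succ_iff hr hs, ih]

theorem HasSplitting.setS_eq (hN : ∀ n, IsNormOn (N n)) {P : ℕ → (E →L[ℝ] E)} {K α β : ℝ}
    (h : HasSplitting A N P K α β) (hK : 0 < K) (hα : 0 < α) {s : ℝ} (hαs : α ≤ s) (hsβ : s < β)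
    (n : ℕ) : SetS A N s n = {v | P n v = v} := by
  have hs : 0 < s := hα.trans_le hαs
  have hβ : 0 < β := hs.trans hsβ
  ext v
  rw [mem_setS_iff hs, Set.mem_ofPred_eq]
  constructor
  · rintro ⟨C, hC⟩
    have hbound (k : ℕ) : N n (v - P n v) ≤ K * C * (s / β) ^ k := by
      have h1 := (h.unstable n k v).trans (mul_le_mul_of_nonneg_left (hC k) hK.le)
      rw [div_pow, ← mul_div_assoc, le_div_iff₀ (by positivity)]
      linarith
    have hlim : Filter.Tendsto (fun k : ℕ => K * C * (s / β) ^ k) Filter.atTop (nhds 0) := by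
      simpa using (tendsto_pow_atTop_nhds_zero_of_lt_one (by positivity)
        ((div_lt_one hβ).2 hsβ)).const_mul (K * C)
    have hzero := ge_of_tendsto' hlim hbound
    have := ((hN n).2.1 _).1 (le_antisymm hzero ((hN n).1 _))
    exact (sub_eq_zero.1 this).symm
  · intro hv
    refine ⟨K * N n v, fun k => ?_⟩
    have h1 := h.stable n k v
    rw [hv] at h1
    have := (hN n).1 v
    calc _ ≤ K * α ^ k * N n v := h1
      _ ≤ K * s ^ k * N n v := by gcongr
      _ = _ := by ring

/-- Two splittings with the same images combine the stable rate of the first with the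
unstable rate of the second. -/
theorem HasSplitting.combine (hN : ∀ n, IsNormOn (N n)) {P P' : ℕ → (E →L[ℝ] E)}
    {K K' α α' β β' : ℝ} (h : HasSplitting A N P K α β) (h' : HasSplitting A N P' K' α' β')
    (hK : 0 < K) (hK' : 0 < K') (hα : 0 < α) (hβ' : 0 < β')
    (hPP : ∀ n, {v | P n v = v} = {v | P' n v = v}) :
    HasSplitting A N P (K * K' + K) α β' where
  idem := h.idem
  comm := h.comm
  stable n k x := (h.stable n k x).trans <| by
    have := (hN n).1 x
    gcongr
    nlinarith [mul_pos hK hK']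
  unstable n k x := by
    have hfix : P n (P' n x) = P' n x := by
      have : P' n x ∈ {v | P' n v = v} := h'.idem n x
      rwa [← hPP] at this
    have hQ : x - P n x = (x - P' n x) - P n (x - P' n x) := by
      rw [map_sub, hfix]; abel
    have h1 := h.unstable n 0 (x - P' n x)
    simp only [pow_zero, one_mul, add_zero, ← hQ] at h1
    have h2 := h'.unstable n k x
    have h3 := (hN (n + k)).1 (fwd A n k x)
    calc β' ^ k * N n (x - P n x) ≤ β' ^ k * (K * N n (x - P' n x)) :=
          mul_le_mul_of_nonneg_left h1 (by positivity)
      _ = K * (β' ^ k * N n (x - P' n x)) := by ring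
      _ ≤ K * (K' * N (n + k) (fwd A n k x)) := by gcongr
      _ ≤ _ := by nlinarith [mul_nonneg hK.le h3]

theorem exists_hasSplitting (hN : ∀ n, IsNormOn (N n)) {τ : ℝ} (hτ : 0 < τ)
    (h : StrongExpDichotomyWRT (fun n => scale τ⁻¹ (A n)) N) :
    ∃ P K α β, 0 < K ∧ 0 < α ∧ α < τ ∧ τ < β ∧ HasSplitting A N P K α β := by
  obtain ⟨P, K, lam, a, hK, hlam, -, hidem, hcomm, hest⟩ := h
  have hτ' : τ⁻¹ ≠ 0 := inv_ne_zero hτ.ne'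
  have hcomm' (n : ℕ) (x : E) : A n (P n x) = P (n + 1) (A n x) := by
    have := DFunLike.congr_fun (hcomm n) x
    simp only [ContinuousLinearMap.comp_apply, ContinuousLinearEquiv.coe_coe,
      scale_apply hτ', map_smul] at this
    exact smul_right_injective E hτ' this
  refine ⟨P, K, τ * Real.exp (-lam), τ * Real.exp lam, hK, by positivity, ?_, ?_, ?_, hcomm',
    ?_, ?_⟩
  · exact mul_lt_of_lt_one_right hτ (by simpa using hlam)
  · exact lt_mul_of_one_lt_right hτ (by simpa using hlam)
  · exact fun n x => DFunLike.congr_fun (hidem n) x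
  · intro n k x
    have h1 := (hest (n + k) n (Nat.le_add_right n k) x).1
    rw [coc_add_left, fwd_scale_apply A hτ', (hN _).map_smul_of_nonneg (by positivity),
      exp_mul_natCast_add_sub, inv_pow, inv_mul_le_iff₀ (by positivity)] at h1
    rw [mul_pow]
    linarith
  · intro n k x
    have h1 := (hest (n + k) n (Nat.le_add_right n k) (fwd A n k x)).2.1
    rw [coc_add_right, fwd_scale_symm_apply A hτ', (hN _).map_smul_of_nonneg (by positivity),
      exp_mul_natCast_add_sub, inv_inv, ← fwd_comm_of_invariant A hcomm', ← map_sub,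
      ContinuousLinearEquiv.symm_apply_apply, Real.exp_neg, inv_pow] at h1
    have hpos : 0 < Real.exp lam ^ k := by positivity
    calc _ = Real.exp lam ^ k * (τ ^ k * N n (x - P n x)) := by ring
      _ ≤ Real.exp lam ^ k * (K * (Real.exp lam ^ k)⁻¹ * N (n + k) (fwd A n k x)) := by gcongr
      _ = _ := by field_simp

theorem HasSplitting.strongExpDichotomyWRT (hN : ∀ n, IsNormOn (N n)) {K₀ a : ℝ}
    (hbg : ∀ m n : ℕ, n ≤ m → ∀ x : E,
      N m (coc A m n x) ≤ K₀ * Real.exp (a * ((m : ℝ) - n)) * N n x ∧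
      N n (coc A n m x) ≤ K₀ * Real.exp (a * ((m : ℝ) - n)) * N m x)
    {P : ℕ → (E →L[ℝ] E)} {K α β τ : ℝ} (h : HasSplitting A N P K α β) (hK : 0 < K)
    (hα : 0 < α) (hατ : α < τ) (hτβ : τ < β) :
    StrongExpDichotomyWRT (fun n => scale τ⁻¹ (A n)) N := by
  have hτ : 0 < τ := hα.trans hατ
  have hβ : 0 < β := hτ.trans hτβ
  have hτ' : τ⁻¹ ≠ 0 := inv_ne_zero hτ.ne'
  obtain ⟨lam, hlam, hlα, hlβ⟩ : ∃ lam : ℝ, 0 < lam ∧ α ≤ τ * Real.exp (-lam) ∧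
      τ ≤ Real.exp (-lam) * β := by
    refine ⟨min (Real.log (τ / α)) (Real.log (β / τ)),
      lt_min (Real.log_pos ((one_lt_div hα).2 hατ)) (Real.log_pos ((one_lt_div hτ).2 hτβ)), ?_, ?_⟩
    · calc α = τ * Real.exp (-Real.log (τ / α)) := by
            rw [Real.exp_neg, Real.exp_log (by positivity)]; field_simp
        _ ≤ _ := by gcongr; exact min_le_left _ _
    · calc τ = Real.exp (-Real.log (β / τ)) * β := by
            rw [Real.exp_neg, Real.exp_log (by positivity)]; field_simp
        _ ≤ _ := by gcongr; exact min_le_right _ _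
  obtain ⟨b, hlb, hτb, hτb'⟩ : ∃ b : ℝ, lam ≤ b ∧ Real.exp a ≤ τ * Real.exp b ∧
      τ * Real.exp a ≤ Real.exp b := by
    refine ⟨max lam (a + |Real.log τ|), le_max_left _ _, ?_, ?_⟩
    · rw [← Real.exp_log hτ, ← Real.exp_add, Real.log_exp]
      gcongr
      linarith [neg_abs_le (Real.log τ), le_max_right lam (a + |Real.log τ|)]
    · nth_rw 1 [← Real.exp_log hτ]
      rw [← Real.exp_add]
      gcongr
      linarith [le_abs_self (Real.log τ), le_max_right lam (a + |Real.log τ|)]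
  refine ⟨P, max K K₀, lam, b, lt_max_of_lt_left hK, hlam, hlb, ?_, ?_, ?_⟩
  · exact fun n => ContinuousLinearMap.ext (h.idem n)
  · intro n
    ext1 x
    simp only [ContinuousLinearMap.comp_apply, ContinuousLinearEquiv.coe_coe,
      scale_apply hτ', map_smul, h.comm]
  intro m n hnm x
  obtain ⟨k, rfl⟩ := Nat.exists_eq_add_of_le hnm
  have hx := (hN n).1 x
  have hx' := (hN (n + k)).1 x
  obtain ⟨hg₁, hg₂⟩ := hbg (n + k) n hnm x
  rw [coc_add_left, exp_mul_natCast_add_sub] at hg₁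
  rw [coc_add_right, exp_mul_natCast_add_sub] at hg₂
  simp only [coc_add_left, coc_add_right, fwd_scale_apply A hτ', fwd_scale_symm_apply A hτ',
    exp_mul_natCast_add_sub, inv_inv, inv_pow]
  rw [(hN _).map_smul_of_nonneg (by positivity), (hN _).map_smul_of_nonneg (by positivity),
    (hN _).map_smul_of_nonneg (by positivity), (hN _).map_smul_of_nonneg (by positivity),
    inv_mul_le_iff₀ (by positivity), inv_mul_le_iff₀ (by positivity)]
  refine ⟨?_, ?_, ?_, ?_⟩
  · calc _ ≤ K * α ^ k * N n x := h.stable n k x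
      _ ≤ max K K₀ * (τ * Real.exp (-lam)) ^ k * N n x := by gcongr; exact le_max_left _ _
      _ = _ := by rw [mul_pow]; ring
  · have h1 := h.unstable n k ((fwd A n k).symm x)
    have hQ : (fwd A n k).symm (x - P (n + k) x) =
        (fwd A n k).symm x - P n ((fwd A n k).symm x) := by
      rw [ContinuousLinearEquiv.symm_apply_eq, map_sub, fwd_comm_of_invariant A h.comm,
        ContinuousLinearEquiv.apply_symm_apply]
    rw [ContinuousLinearEquiv.apply_symm_apply, ← hQ] at h1
    have hy := (hN n).1 ((fwd A n k).symm (x - P (n + k) x))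
    calc _ ≤ (Real.exp (-lam) * β) ^ k * N n ((fwd A n k).symm (x - P (n + k) x)) := by gcongr
      _ = Real.exp (-lam) ^ k * (β ^ k * N n ((fwd A n k).symm (x - P (n + k) x))) := by ring
      _ ≤ Real.exp (-lam) ^ k * (K * N (n + k) x) := by gcongr
      _ ≤ Real.exp (-lam) ^ k * (max K K₀ * N (n + k) x) := by gcongr; exact le_max_left _ _
      _ = _ := by ring
  · calc _ ≤ K₀ * Real.exp a ^ k * N n x := hg₁
      _ ≤ max K K₀ * (τ * Real.exp b) ^ k * N n x := by gcongr; exact le_max_right _ _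
      _ = _ := by rw [mul_pow]; ring
  · calc _ ≤ τ ^ k * (K₀ * Real.exp a ^ k * N (n + k) x) := by gcongr
      _ = K₀ * (τ * Real.exp a) ^ k * N (n + k) x := by rw [mul_pow]; ring
      _ ≤ _ := by gcongr; exact le_max_right _ _

theorem exists_hasSplitting_of_notMem_sigmaED (hN : ∀ n, IsNormOn (N n)) {τ : ℝ} (hτ : 0 < τ)
    (h : τ ∉ SigmaED A N) :
    ∃ P K α β, 0 < K ∧ 0 < α ∧ α < τ ∧ τ < β ∧ HasSplitting A N P K α β :=
  exists_hasSplitting hN hτ (by_contra fun hc => h ⟨hτ, hc⟩)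

theorem eventually_setS_eq (hN : ∀ n, IsNormOn (N n)) {τ : ℝ} (hτ : 0 < τ)
    (h : τ ∉ SigmaED A N) (n : ℕ) : ∀ᶠ s in nhds τ, SetS A N τ n = SetS A N s n := by
  obtain ⟨P, K, α, β, hK, hα, hατ, hτβ, hs⟩ := exists_hasSplitting_of_notMem_sigmaED hN hτ h
  filter_upwards [Ioo_mem_nhds hατ hτβ] with s hsm
  rw [hs.setS_eq hN hK hα hατ.le hτβ, hs.setS_eq hN hK hα hsm.1.le hsm.2]

end Splitting

/-- Lemma: two points in the resolvent have the same stable sets iff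
the whole interval between them lies in the resolvent. -/
theorem setS_eq_iff_Icc_disjoint_sigmaED {d : ℕ}
    (A : ℕ → (EuclideanSpace ℝ (Fin d) ≃L[ℝ] EuclideanSpace ℝ (Fin d)))
    (N : ℕ → EuclideanSpace ℝ (Fin d) → ℝ)
    (hN : ∀ n : ℕ, IsNormOn (N n))
    (K a : ℝ) (hK : 0 < K) (ha : 0 < a)
    (hbg : ∀ m n : ℕ, n ≤ m → ∀ x : EuclideanSpace ℝ (Fin d),
      N m (coc A m n x) ≤ K * Real.exp (a * ((m : ℝ) - n)) * N n x ∧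
      N n (coc A n m x) ≤ K * Real.exp (a * ((m : ℝ) - n)) * N m x) :
    ∀ r₁ r₂ : ℝ, 0 < r₁ → r₁ < r₂ →
      r₁ ∉ SigmaED A N → r₂ ∉ SigmaED A N →
        ((∃ n : ℕ, SetS A N r₁ n = SetS A N r₂ n) ↔
          (∀ n : ℕ, SetS A N r₁ n = SetS A N r₂ n)) ∧
        ((∃ n : ℕ, SetS A N r₁ n = SetS A N r₂ n) ↔
          Set.Icc r₁ r₂ ∩ SigmaED A N = ∅) := by
  intro r₁ r₂ hr₁ hr hm₁ hm₂
  have hr₂ : 0 < r₂ := hr₁.trans hr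
  have hall : (∃ n : ℕ, SetS A N r₁ n = SetS A N r₂ n) ↔
      (∀ n : ℕ, SetS A N r₁ n = SetS A N r₂ n) := by
    simp only [setS_eq_iff_zero hr₁ hr₂, exists_const, forall_const]
  refine ⟨hall, hall.trans ⟨fun heq => ?_, fun hdisj => ?_⟩⟩
  · obtain ⟨P, K₁, α, β, hK₁, hα, hαr, hrβ, hs⟩ :=
      exists_hasSplitting_of_notMem_sigmaED hN hr₁ hm₁
    obtain ⟨P', K₂, α', β', hK₂, hα', hαr', hrβ', hs'⟩ :=
      exists_hasSplitting_of_notMem_sigmaED hN hr₂ hm₂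
    have hcomb := hs.combine hN hs' hK₁ hK₂ hα (hr₂.trans hrβ') fun n => by
      rw [← hs.setS_eq hN hK₁ hα hαr.le hrβ, heq, hs'.setS_eq hN hK₂ hα' hαr'.le hrβ']
    refine Set.eq_empty_of_forall_notMem fun τ ⟨hτ, hτS⟩ => hτS.2 ?_
    exact hcomb.strongExpDichotomyWRT hN hbg (by positivity) hα (hαr.trans_le hτ.1)
      (hτ.2.trans_lt hrβ')
  · intro n
    refine isPreconnected_Icc.induction₂ (fun s t => SetS A N s n = SetS A N t n)
      (fun τ hτ => ?_) (fun _ _ _ _ _ _ => Eq.trans) (fun _ _ _ _ => Eq.symm)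
      (Set.left_mem_Icc.2 hr.le) (Set.right_mem_Icc.2 hr.le)
    exact (eventually_setS_eq hN (hr₁.trans_le hτ.1)
      (fun hc => Set.notMem_empty τ (hdisj ▸ ⟨hτ, hc⟩)) n).filter_mono nhdsWithin_le_nhds

end NonautLin
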